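/- Under hypotheses (1)–(5) of the discrete approximation result (μ = μ_D × H^N⌞E with uniformly bounded and uniformly tight thermalizations μ_β for β ≥ β₀; μ_h = (Σ_{p∈P_h} m_p δ_p) × H^N⌞E with partitions {A_p}, β_h → ∞, ε_h → 0, (β_h ε_h²) bounded, ‖p − z‖² ≤ c_*²(ε_h² + ‖y − z‖²) for z ∈ E, y ∈ A_p, and ∫_{A_p} ‖y − p‖² dμ_D ≤ ε_h² μ_D(A_p)), assume in addition there is δ_h → 0 with |m_p − μ_D(A_p)| ≤ δ_h μ_D(A_p) for all p ∈ P_h. Then there is a constant C such that for all sufficiently large h, ‖(μ_h)_{β_h} − μ_{β_h}‖_FN ≤ C (δ_h + β_h^{1/2} ε_h) · sup_{β ≥ β₀} ‖μ_β‖_TV. -/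

import Mathlib

open MeasureTheory Real Filter Topology

noncomputable section

/-- Phase space `Z`, identified with `ℝ^{2N}` (with Lebesgue measure `volume`). -/
abbrev ZZ (N : ℕ) := EuclideanSpace ℝ (Fin (2 * N))

/-- The normalization constant `B_β = ∫_Z exp(−β‖ξ‖²) dL^{2N}(ξ)`. -/
def Bconst (N : ℕ) (β : ℝ) : ℝ := ∫ ξ : ZZ N, Real.exp (-β * ‖ξ‖ ^ 2)

/-- The thermalization `μ_β := w_β · μ` with `w_β(y,z) = B_β⁻¹ exp(−β‖y−z‖²)`. -/
def therm {N : ℕ} (μ : Measure (ZZ N × ZZ N)) (β : ℝ) : Measure (ZZ N × ZZ N) :=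
  μ.withDensity fun q => ENNReal.ofReal ((Bconst N β)⁻¹ * Real.exp (-β * ‖q.1 - q.2‖ ^ 2))

/-- The deterministic physical likelihood `μ_E = H^N ⌞ E`. -/
def muE (N : ℕ) (E : AffineSubspace ℝ (ZZ N)) : Measure (ZZ N) :=
  (μH[(N : ℝ)]).restrict (E : Set (ZZ N))

/-- The sub-Gaussian material likelihood `μ_D = e^{−Φ} L^{2N}`. -/
def muD (N : ℕ) (Φ : ZZ N → ℝ) : Measure (ZZ N) :=
  volume.withDensity fun y => ENNReal.ofReal (Real.exp (-Φ y))

theorem abs_exp_neg_sq_sub_exp_neg_sq_le {a b d e c : ℝ} (ha : 0 ≤ a) (hb : 0 ≤ b)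
    (hab : |a - b| ≤ d) (hc : 1 ≤ c) (hcell : a ^ 2 ≤ c ^ 2 * (e ^ 2 + b ^ 2)) :
    |exp (-a ^ 2) - exp (-b ^ 2)| ≤
      exp (e ^ 2) * (2 * c * d + d ^ 2) * exp (-(a ^ 2 / (2 * c ^ 2))) := by
  have hc0 : 0 < c := by linarith
  have hd : 0 ≤ d := (abs_nonneg _).trans hab
  obtain ⟨h1, h2⟩ := abs_le.1 hab
  set G := exp (-(a ^ 2 / (2 * c ^ 2))) with hG
  have hE1 : 1 ≤ exp (e ^ 2) := one_le_exp (sq_nonneg e)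
  have hG0 : 0 < G := exp_pos _
  have hGG : exp (-(a ^ 2 / c ^ 2)) = G * G := by
    rw [hG, ← exp_add]; congr 1; field_simp; ring
  have hG1 : G ≤ 1 := exp_le_one_iff.2 (neg_nonpos.2 (by positivity))
  have haG : a * G ≤ c := by
    have h : a / c ≤ exp (a ^ 2 / (2 * c ^ 2)) := by
      have := add_one_le_exp (a ^ 2 / (2 * c ^ 2))
      have h3 : a ^ 2 / (2 * c ^ 2) = (a / c) ^ 2 / 2 := by field_simp
      nlinarith [sq_nonneg (a / c - 1)]
    rw [hG, exp_neg, ← div_eq_mul_inv, div_le_iff₀ (exp_pos _)]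
    rw [div_le_iff₀ hc0] at h
    linarith
  have key : ∀ x y : ℝ, x ≤ y → |exp (-x) - exp (-y)| ≤ exp (-x) * (y - x) := by
    intro x y hxy
    rw [abs_of_nonneg (sub_nonneg.2 (exp_le_exp.2 (by linarith)))]
    have h3 : exp (-y) = exp (-x) * exp (x - y) := by rw [← exp_add]; congr 1; ring
    have := add_one_le_exp (x - y)
    rw [h3]
    nlinarith [exp_pos (-x)]
  rcases le_total b a with hba | hba
  · rw [abs_sub_comm]
    have hEb : exp (-b ^ 2) ≤ exp (e ^ 2) * (G * G) := by
      rw [← hGG, ← exp_add]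
      apply exp_le_exp.2
      have : a ^ 2 / c ^ 2 ≤ e ^ 2 + b ^ 2 := by
        rw [div_le_iff₀ (by positivity)]; linarith
      linarith
    calc |exp (-b ^ 2) - exp (-a ^ 2)| ≤ exp (-b ^ 2) * (a ^ 2 - b ^ 2) :=
          key _ _ (by gcongr)
      _ ≤ (exp (e ^ 2) * (G * G)) * (d * (2 * a)) := by
          refine mul_le_mul hEb ?_ (by nlinarith) (by positivity)
          nlinarith
      _ = exp (e ^ 2) * (2 * d * (a * G)) * G := by ring
      _ ≤ exp (e ^ 2) * (2 * d * c) * G := by gcongr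
      _ ≤ _ := by gcongr; nlinarith [sq_nonneg d]
  · have hEa : exp (-a ^ 2) ≤ G * G := by
      rw [← hGG]
      apply exp_le_exp.2
      have : a ^ 2 / c ^ 2 ≤ a ^ 2 := div_le_self (sq_nonneg a) (by nlinarith)
      linarith
    calc |exp (-a ^ 2) - exp (-b ^ 2)| ≤ exp (-a ^ 2) * (b ^ 2 - a ^ 2) :=
          key _ _ (by gcongr)
      _ ≤ (G * G) * (d * (2 * a + d)) := by
          refine mul_le_mul hEa ?_ (by nlinarith) (by positivity)
          nlinarith
      _ = 1 * (2 * d * (a * G) + d ^ 2 * G) * G := by ring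
      _ ≤ exp (e ^ 2) * (2 * d * c + d ^ 2 * 1) * G := by gcongr
      _ = _ := by ring

theorem abs_mul_exp_sub_mul_exp_le {V : Type*} [NormedAddCommGroup V]
    {β ε c b L : ℝ} (hβ : 1 ≤ β) (hε : 0 < ε) (hc : 1 ≤ c) (hb : β * ε ^ 2 ≤ b) {p y z : V} {u v : ℝ} (hv : |v| ≤ 1)
    (huv : |u - v| ≤ L * ‖y - p‖) (hL : 0 ≤ L)
    (hcell : ‖p - z‖ ^ 2 ≤ c ^ 2 * (ε ^ 2 + ‖y - z‖ ^ 2)) :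
    |u * exp (-β * ‖p - z‖ ^ 2) - v * exp (-β * ‖y - z‖ ^ 2)| ≤
      (L + exp b * (2 * c + b + 1)) * (√β * (ε + ‖y - p‖ ^ 2 / ε)) *
        exp (-(β / (2 * c ^ 2) * ‖p - z‖ ^ 2)) := by
  have hs2 : √β ^ 2 = β := sq_sqrt (by linarith)
  have hs1 : 1 ≤ √β := one_le_sqrt.2 hβ
  have hs0 : 0 ≤ √β := sqrt_nonneg β
  set d := ‖y - p‖ with hd
  have hd0 : 0 ≤ d := norm_nonneg _
  have hb0 : 0 ≤ b := le_trans (by positivity) hb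
  have htri : |‖p - z‖ - ‖y - z‖| ≤ d := by
    have := abs_norm_sub_norm_le (p - z) (y - z)
    rwa [sub_sub_sub_cancel_right, norm_sub_rev p y] at this
  have hdiff := abs_exp_neg_sq_sub_exp_neg_sq_le (a := √β * ‖p - z‖) (b := √β * ‖y - z‖)
    (d := √β * d) (e := √β * ε) (by positivity) (by positivity)
    (by rw [← mul_sub, abs_mul, abs_of_nonneg hs0]; gcongr) hc
    (by simp only [mul_pow, hs2]
        nlinarith [mul_le_mul_of_nonneg_left hcell (by linarith : 0 ≤ β)])
  simp only [mul_pow, hs2] at hdiff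
  rw [← neg_mul, ← neg_mul, show β * ‖p - z‖ ^ 2 / (2 * c ^ 2) = β / (2 * c ^ 2) * ‖p - z‖ ^ 2 by
    ring] at hdiff
  set G := exp (-(β / (2 * c ^ 2) * ‖p - z‖ ^ 2)) with hG
  have hG0 : 0 < G := exp_pos _
  have hEp : exp (-β * ‖p - z‖ ^ 2) ≤ G := by
    apply exp_le_exp.2
    have : β / (2 * c ^ 2) ≤ β := div_le_self (by linarith) (by nlinarith)
    nlinarith [mul_le_mul_of_nonneg_right this (sq_nonneg ‖p - z‖)]
  set X := √β * (ε + d ^ 2 / ε) with hX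
  have hdX : √β * d ≤ X := by
    rw [hX]
    gcongr
    have : d ^ 2 / ε * ε = d ^ 2 := by field_simp
    have h3 : 0 ≤ d ^ 2 / ε := by positivity
    by_contra! hlt
    nlinarith [sq_nonneg (d - ε)]
  have hβdX : β * d ^ 2 ≤ (b + 1) * X := by
    have h1 : √β * ε ≤ b + 1 := by
      nlinarith [sq_nonneg (√β * ε - 1), mul_pow (√β) ε 2]
    have h2 : β * d ^ 2 = (√β * ε) * (√β * (d ^ 2 / ε)) := by
      field_simp
      rw [hs2, mul_comm]
    rw [h2, hX]
    gcongr
    linarith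
  calc |u * exp (-β * ‖p - z‖ ^ 2) - v * exp (-β * ‖y - z‖ ^ 2)|
      = |(u - v) * exp (-β * ‖p - z‖ ^ 2) +
          v * (exp (-β * ‖p - z‖ ^ 2) - exp (-β * ‖y - z‖ ^ 2))| := by congr 1; ring
    _ ≤ |u - v| * exp (-β * ‖p - z‖ ^ 2) +
          |v| * |exp (-β * ‖p - z‖ ^ 2) - exp (-β * ‖y - z‖ ^ 2)| := by
        refine (abs_add_le _ _).trans_eq ?_
        rw [abs_mul, abs_mul, abs_of_nonneg (exp_pos (-β * ‖p - z‖ ^ 2)).le]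
    _ ≤ (L * (√β * d)) * G +
          1 * (exp (β * ε ^ 2) * (2 * c * (√β * d) + β * d ^ 2) * G) := by
        gcongr
        refine huv.trans ?_
        gcongr
        nlinarith
    _ ≤ (L * X) * G + 1 * (exp b * (2 * c * X + (b + 1) * X) * G) := by gcongr
    _ = _ := by ring

section Cell

variable {V : Type*} [NormedAddCommGroup V] [MeasurableSpace V] [BorelSpace V]

theorem integrable_exp_neg_mul_norm_sub_sq (κ : Measure V) [IsFiniteMeasure κ] {γ : ℝ}
    (hγ : 0 ≤ γ) (z : V) : Integrable (fun y => exp (-γ * ‖y - z‖ ^ 2)) κ := by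
  refine Integrable.of_bound (Continuous.aestronglyMeasurable (by fun_prop)) 1 (ae_of_all _ ?_)
  intro y
  rw [norm_of_nonneg (exp_pos _).le]
  exact exp_le_one_iff.2 (by nlinarith [mul_nonneg hγ (sq_nonneg ‖y - z‖)])

theorem measureReal_univ_mul_exp_le (κ : Measure V) [IsFiniteMeasure κ] {γ ε : ℝ}
    (hγ : 0 ≤ γ) (p z : V) (hint : Integrable (fun y => ‖y - p‖ ^ 2) κ)
    (hmom : ∫ y, ‖y - p‖ ^ 2 ∂κ ≤ ε ^ 2 * κ.real Set.univ) :
    κ.real Set.univ * exp (-(2 * γ * ‖p - z‖ ^ 2)) ≤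
      exp (2 * γ * ε ^ 2) * ∫ y, exp (-γ * ‖y - z‖ ^ 2) ∂κ := by
  have hpt : ∀ y, exp (-(2 * γ * ‖p - z‖ ^ 2)) * (1 + 2 * γ * ε ^ 2 - 2 * γ * ‖y - p‖ ^ 2) ≤
      exp (2 * γ * ε ^ 2) * exp (-γ * ‖y - z‖ ^ 2) := by
    intro y
    have h1 : ‖y - z‖ ≤ ‖y - p‖ + ‖p - z‖ := norm_sub_le_norm_sub_add_norm_sub y p z
    have h2 : ‖y - z‖ ^ 2 ≤ 2 * ‖y - p‖ ^ 2 + 2 * ‖p - z‖ ^ 2 := by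
      nlinarith [norm_nonneg (y - z), sq_nonneg (‖y - p‖ - ‖p - z‖)]
    calc _ ≤ exp (-(2 * γ * ‖p - z‖ ^ 2)) * exp (2 * γ * ε ^ 2 - 2 * γ * ‖y - p‖ ^ 2) := by
          gcongr
          linarith [add_one_le_exp (2 * γ * ε ^ 2 - 2 * γ * ‖y - p‖ ^ 2)]
      _ ≤ _ := by
          rw [← exp_add, ← exp_add]
          apply exp_le_exp.2
          nlinarith
  rw [← integral_const_mul]
  refine le_trans ?_ (integral_mono (((integrable_const _).sub (hint.const_mul _)).const_mul _)
    ((integrable_exp_neg_mul_norm_sub_sq κ hγ z).const_mul _) hpt)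
  rw [integral_const_mul, mul_comm]
  gcongr
  simp only [Pi.sub_apply]
  rw [integral_sub (integrable_const _) (hint.const_mul _), integral_const, integral_const_mul,
    smul_eq_mul]
  nlinarith [mul_le_mul_of_nonneg_left hmom (by positivity : 0 ≤ 2 * γ)]

theorem abs_weighted_value_sub_integral_le (κ : Measure V) [IsFiniteMeasure κ]
    {β ε c b L M δ : ℝ} (hβ : 1 ≤ β) (hε : 0 < ε) (hc : 1 ≤ c) (hb : β * ε ^ 2 ≤ b)
    (hL : 0 ≤ L) {p z : V} (hint : Integrable (fun y => ‖y - p‖ ^ 2) κ)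
    (hmom : ∫ y, ‖y - p‖ ^ 2 ∂κ ≤ ε ^ 2 * κ.real Set.univ)
    (hcell : ∀ᵐ y ∂κ, ‖p - z‖ ^ 2 ≤ c ^ 2 * (ε ^ 2 + ‖y - z‖ ^ 2))
    (hM : |M - κ.real Set.univ| ≤ δ * κ.real Set.univ) (hδ : 0 ≤ δ)
    {F : V → ℝ} (hF : ∀ y, |F y| ≤ 1) (hFm : AEStronglyMeasurable F κ)
    (hFL : ∀ y, |F p - F y| ≤ L * ‖y - p‖) :
    |M * (F p * exp (-β * ‖p - z‖ ^ 2)) - ∫ y, F y * exp (-β * ‖y - z‖ ^ 2) ∂κ| ≤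
      (2 * (L + exp b * (2 * c + b + 1)) + 1) * exp b * (δ + √β * ε) *
        ∫ y, exp (-(β / (4 * c ^ 2)) * ‖y - z‖ ^ 2) ∂κ := by
  have hb0 : 0 ≤ b := le_trans (by positivity) hb
  set K := L + exp b * (2 * c + b + 1) with hK
  have hK0 : 0 ≤ K := by positivity
  set G := exp (-(β / (2 * c ^ 2) * ‖p - z‖ ^ 2)) with hG
  set W := κ.real Set.univ with hW
  have hW0 : 0 ≤ W := measureReal_nonneg
  have hEp : exp (-β * ‖p - z‖ ^ 2) ≤ G := by
    apply exp_le_exp.2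
    have : β / (2 * c ^ 2) ≤ β := div_le_self (by linarith) (by nlinarith)
    nlinarith [mul_le_mul_of_nonneg_right this (sq_nonneg ‖p - z‖)]
  have hWG : W * G ≤ exp b * ∫ y, exp (-(β / (4 * c ^ 2)) * ‖y - z‖ ^ 2) ∂κ := by
    have h := measureReal_univ_mul_exp_le κ (γ := β / (4 * c ^ 2)) (by positivity) p z hint hmom
    rw [show 2 * (β / (4 * c ^ 2)) = β / (2 * c ^ 2) by field_simp; norm_num] at h
    refine h.trans ?_
    have hI : 0 ≤ ∫ y, exp (-(β / (4 * c ^ 2)) * ‖y - z‖ ^ 2) ∂κ :=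
      integral_nonneg fun y => (exp_pos _).le
    gcongr
    refine le_trans ?_ hb
    gcongr
    exact div_le_self (by linarith) (by nlinarith)
  have hFint : Integrable (fun y => F y * exp (-β * ‖y - z‖ ^ 2)) κ :=
    (integrable_exp_neg_mul_norm_sub_sq κ (by linarith) z).bdd_mul (c := 1) hFm
      (ae_of_all _ fun y => by simpa using hF y)
  have hsecond : |W * (F p * exp (-β * ‖p - z‖ ^ 2)) - ∫ y, F y * exp (-β * ‖y - z‖ ^ 2) ∂κ| ≤
      2 * K * (√β * ε) * (W * G) := by
    have hconst : W * (F p * exp (-β * ‖p - z‖ ^ 2)) =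
        ∫ _, F p * exp (-β * ‖p - z‖ ^ 2) ∂κ := by simp [hW]
    rw [hconst, ← integral_sub (integrable_const _) hFint]
    refine (abs_integral_le_integral_abs).trans ?_
    have hXint : Integrable (fun y => K * (√β * (ε + ‖y - p‖ ^ 2 / ε)) * G) κ :=
      ((((integrable_const ε).add (hint.div_const ε)).const_mul _).const_mul _).mul_const _
    refine (integral_mono_ae ((integrable_const _).sub hFint).abs hXint ?_).trans ?_
    · filter_upwards [hcell] with y hy
      exact abs_mul_exp_sub_mul_exp_le hβ hε hc hb (hF y) (hFL y) hL hy
    · rw [integral_mul_const, integral_const_mul, integral_const_mul,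
        integral_add (integrable_const _) (hint.div_const ε), integral_div, integral_const,
        smul_eq_mul]
      have h1 : (∫ y, ‖y - p‖ ^ 2 ∂κ) / ε ≤ ε * W := by
        rw [div_le_iff₀ hε]; nlinarith
      calc K * (√β * (W * ε + (∫ y, ‖y - p‖ ^ 2 ∂κ) / ε)) * G
          ≤ K * (√β * (W * ε + ε * W)) * G := by gcongr
        _ = _ := by ring
  have hfirst : |(M - W) * (F p * exp (-β * ‖p - z‖ ^ 2))| ≤ δ * (W * G) := by
    rw [abs_mul, abs_mul, abs_of_nonneg (exp_pos (-β * ‖p - z‖ ^ 2)).le]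
    calc |M - W| * (|F p| * exp (-β * ‖p - z‖ ^ 2)) ≤ (δ * W) * (1 * G) := by
          gcongr
          exact hF p
      _ = _ := by ring
  have hsε : 0 ≤ √β * ε := by positivity
  calc _ = |(M - W) * (F p * exp (-β * ‖p - z‖ ^ 2)) +
          (W * (F p * exp (-β * ‖p - z‖ ^ 2)) - ∫ y, F y * exp (-β * ‖y - z‖ ^ 2) ∂κ)| := by
        congr 1; ring
    _ ≤ δ * (W * G) + 2 * K * (√β * ε) * (W * G) :=
        (abs_add_le _ _).trans (add_le_add hfirst hsecond)
    _ ≤ (2 * K + 1) * (δ + √β * ε) * (W * G) := by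
        rw [← add_mul]
        gcongr
        nlinarith [mul_nonneg hK0 hδ]
    _ ≤ (2 * K + 1) * (δ + √β * ε) *
          (exp b * ∫ y, exp (-(β / (4 * c ^ 2)) * ‖y - z‖ ^ 2) ∂κ) := by gcongr
    _ = _ := by ring

end Cell

theorem Bconst_eq (N : ℕ) {β : ℝ} (hβ : 0 < β) : Bconst N β = (π / β) ^ N := by
  rw [Bconst, GaussianFourier.integral_rexp_neg_mul_sq_norm hβ, finrank_euclideanSpace_fin,
    ← rpow_natCast]
  congr 1
  push_cast
  ring

theorem Bconst_pos (N : ℕ) {β : ℝ} (hβ : 0 < β) : 0 < Bconst N β := by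
  rw [Bconst_eq N hβ]
  positivity

theorem inv_Bconst_eq_mul_inv_Bconst_div (N : ℕ) {β t : ℝ} (hβ : 0 < β) (ht : 0 < t) :
    (Bconst N β)⁻¹ = t ^ N * (Bconst N (β / t))⁻¹ := by
  rw [Bconst_eq N hβ, Bconst_eq N (div_pos hβ ht), ← inv_pow, ← inv_pow, ← mul_pow]
  congr 1
  field_simp

theorem sFinite_muE {N : ℕ} {E : AffineSubspace ℝ (ZZ N)} (hE : (E : Set (ZZ N)).Nonempty)
    (hdim : Module.finrank ℝ E.direction = N) : SFinite (muE N E) := by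
  obtain ⟨x, hx⟩ := hE
  let φ : E.direction → ZZ N := fun v => (v : ZZ N) + x
  have hφ : Isometry φ := (IsometryEquiv.addRight x).isometry.comp isometry_subtype_coe
  have hrange : Set.range φ = E := by
    ext y
    constructor
    · rintro ⟨v, rfl⟩
      exact AffineSubspace.vadd_mem_of_mem_direction v.2 hx
    · intro hy
      exact ⟨⟨y - x, AffineSubspace.vsub_mem_direction hy hx⟩, sub_add_cancel y x⟩
  have hmap := hφ.map_hausdorffMeasure (d := (N : ℝ)) (Or.inl (Nat.cast_nonneg N))
  rw [hrange] at hmap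
  rw [muE, ← hmap]
  have h := isAddHaarMeasure_hausdorffMeasure (E := E.direction)
  rw [hdim] at h
  infer_instance

theorem ae_muE_mem {N : ℕ} (E : AffineSubspace ℝ (ZZ N)) : ∀ᵐ z ∂muE N E, z ∈ E :=
  ae_restrict_mem E.closed_of_finiteDimensional.measurableSet

section Therm

variable {N : ℕ}

theorem measurable_therm_density (N : ℕ) (β : ℝ) : Measurable fun q : ZZ N × ZZ N =>
    ENNReal.ofReal ((Bconst N β)⁻¹ * exp (-β * ‖q.1 - q.2‖ ^ 2)) := by
  fun_prop

theorem therm_sum {ι : Type*} (κ : ι → Measure (ZZ N)) (lam : Measure (ZZ N)) [SFinite lam]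
    (β : ℝ) : therm ((Measure.sum κ).prod lam) β =
      Measure.sum fun i => therm ((κ i).prod lam) β := by
  rw [Measure.prod_sum_left]
  exact withDensity_sum _ _

theorem therm_prod_univ (κ lam : Measure (ZZ N)) [IsFiniteMeasure κ] [SFinite lam] {β : ℝ}
    (hβ : 0 < β) : therm (κ.prod lam) β Set.univ =
      ∫⁻ z, ENNReal.ofReal ((Bconst N β)⁻¹ * ∫ y, exp (-β * ‖y - z‖ ^ 2) ∂κ) ∂lam := by
  have hB := Bconst_pos N hβ
  rw [therm, withDensity_apply _ MeasurableSet.univ, Measure.restrict_univ,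
    lintegral_prod_symm _ (measurable_therm_density N β).aemeasurable]
  refine lintegral_congr fun z => ?_
  rw [← integral_const_mul, ofReal_integral_eq_lintegral_ofReal
    ((integrable_exp_neg_mul_norm_sub_sq κ hβ.le z).const_mul _)
    (ae_of_all _ fun y => by positivity)]

theorem integrable_therm_prod (κ lam : Measure (ZZ N)) {β : ℝ} (hβ : 0 < β)
    (hfin : therm (κ.prod lam) β Set.univ < ⊤) {f : ZZ N × ZZ N → ℝ} (hf : ∀ q, |f q| ≤ 1)
    (hfm : Measurable f) :
    Integrable (fun q => (Bconst N β)⁻¹ * (f q * exp (-β * ‖q.1 - q.2‖ ^ 2)))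
      (κ.prod lam) := by
  have hB := Bconst_pos N hβ
  have : IsFiniteMeasure (therm (κ.prod lam) β) := ⟨hfin⟩
  have h : Integrable f (therm (κ.prod lam) β) :=
    Integrable.of_bound hfm.aestronglyMeasurable 1 (ae_of_all _ hf)
  rw [therm, integrable_withDensity_iff_integrable_smul' (measurable_therm_density N β)
    (ae_of_all _ fun _ => ENNReal.ofReal_lt_top)] at h
  refine h.congr (ae_of_all _ fun q => ?_)
  simp only [smul_eq_mul]
  rw [ENNReal.toReal_ofReal (by positivity)]
  ring

theorem integral_therm_prod (κ lam : Measure (ZZ N)) [SFinite κ] [SFinite lam] {β : ℝ}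
    (hβ : 0 < β) (hfin : therm (κ.prod lam) β Set.univ < ⊤) {f : ZZ N × ZZ N → ℝ}
    (hf : ∀ q, |f q| ≤ 1) (hfm : Measurable f) :
    ∫ q, f q ∂therm (κ.prod lam) β =
      ∫ z, (Bconst N β)⁻¹ * ∫ y, f (y, z) * exp (-β * ‖y - z‖ ^ 2) ∂κ ∂lam := by
  have hB := Bconst_pos N hβ
  simp_rw [← integral_const_mul]
  rw [← integral_prod_symm _ (integrable_therm_prod κ lam hβ hfin hf hfm), therm,
    integral_withDensity_eq_integral_toReal_smul (measurable_therm_density N β)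
      (ae_of_all _ fun _ => ENNReal.ofReal_lt_top)]
  refine integral_congr_ae (ae_of_all _ fun q => ?_)
  simp only [smul_eq_mul]
  rw [ENNReal.toReal_ofReal (by positivity)]
  ring

theorem integrable_inner_integral_therm (κ lam : Measure (ZZ N)) [SFinite κ] [SFinite lam]
    {β : ℝ} (hβ : 0 < β) (hfin : therm (κ.prod lam) β Set.univ < ⊤) {f : ZZ N × ZZ N → ℝ}
    (hf : ∀ q, |f q| ≤ 1) (hfm : Measurable f) :
    Integrable (fun z => (Bconst N β)⁻¹ * ∫ y, f (y, z) * exp (-β * ‖y - z‖ ^ 2) ∂κ) lam := by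
  simp_rw [← integral_const_mul]
  exact (integrable_therm_prod κ lam hβ hfin hf hfm).integral_prod_right

theorem therm_prod_univ_le (κ₁ κ₂ lam : Measure (ZZ N)) [IsFiniteMeasure κ₁]
    [IsFiniteMeasure κ₂] [SFinite lam] {β γ T : ℝ} (hβ : 0 < β) (hγ : 0 < γ) (hT : 0 ≤ T)
    (h : ∀ᵐ z ∂lam, (Bconst N β)⁻¹ * ∫ y, exp (-β * ‖y - z‖ ^ 2) ∂κ₁ ≤
      T * ((Bconst N γ)⁻¹ * ∫ y, exp (-γ * ‖y - z‖ ^ 2) ∂κ₂)) :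
    therm (κ₁.prod lam) β Set.univ ≤ ENNReal.ofReal T * therm (κ₂.prod lam) γ Set.univ := by
  rw [therm_prod_univ κ₁ lam hβ, therm_prod_univ κ₂ lam hγ,
    ← lintegral_const_mul' _ _ ENNReal.ofReal_ne_top]
  refine lintegral_mono_ae (h.mono fun z hz => ?_)
  rw [← ENNReal.ofReal_mul hT]
  exact ENNReal.ofReal_le_ofReal hz

theorem integral_therm_sub_integral_therm_le (κ₁ κ₂ lam : Measure (ZZ N)) [SFinite κ₁]
    [SFinite κ₂] [SFinite lam] {β γ T : ℝ} (hβ : 0 < β) (hγ : 0 < γ)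
    (hfin₁ : therm (κ₁.prod lam) β Set.univ < ⊤) (hfin₂ : therm (κ₂.prod lam) β Set.univ < ⊤)
    (hfinγ : therm (κ₂.prod lam) γ Set.univ < ⊤) {f : ZZ N × ZZ N → ℝ}
    (hf : ∀ q, |f q| ≤ 1) (hfm : Measurable f)
    (h : ∀ᵐ z ∂lam, (Bconst N β)⁻¹ * (∫ y, f (y, z) * exp (-β * ‖y - z‖ ^ 2) ∂κ₁) -
        (Bconst N β)⁻¹ * (∫ y, f (y, z) * exp (-β * ‖y - z‖ ^ 2) ∂κ₂) ≤
      T * ((Bconst N γ)⁻¹ * ∫ y, exp (-γ * ‖y - z‖ ^ 2) ∂κ₂)) :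
    (∫ q, f q ∂therm (κ₁.prod lam) β) - (∫ q, f q ∂therm (κ₂.prod lam) β) ≤
      T * (therm (κ₂.prod lam) γ).real Set.univ := by
  have h1 : ∀ q : ZZ N × ZZ N, |(fun _ => (1 : ℝ)) q| ≤ 1 := by simp
  have hone := integral_therm_prod κ₂ lam hγ hfinγ h1 measurable_const
  have hint := integrable_inner_integral_therm κ₂ lam hγ hfinγ h1 measurable_const
  simp only [integral_const, smul_eq_mul, mul_one, one_mul] at hone hint
  rw [integral_therm_prod κ₁ lam hβ hfin₁ hf hfm, integral_therm_prod κ₂ lam hβ hfin₂ hf hfm,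
    hone, ← integral_const_mul, ← integral_sub
      (integrable_inner_integral_therm κ₁ lam hβ hfin₁ hf hfm)
      (integrable_inner_integral_therm κ₂ lam hβ hfin₂ hf hfm)]
  exact integral_mono_ae ((integrable_inner_integral_therm κ₁ lam hβ hfin₁ hf hfm).sub
    (integrable_inner_integral_therm κ₂ lam hβ hfin₂ hf hfm)) (hint.const_mul T) h

end Therm

/-- The constant in front of `δ + √β * ε` in the flat norm estimate. -/
def flatConst (N : ℕ) (c b L : ℝ) : ℝ :=
  (4 * c ^ 2) ^ N * ((2 * (L + exp b * (2 * c + b + 1)) + 1) * exp b)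

theorem flatConst_pos (N : ℕ) {c b L : ℝ} (hc : 1 ≤ c) (hb : 0 ≤ b) (hL : 0 ≤ L) :
    0 < flatConst N c b L := by
  unfold flatConst
  positivity

section ThermCell

variable {N : ℕ} (κ : Measure (ZZ N)) [IsFiniteMeasure κ] {E : AffineSubspace ℝ (ZZ N)}
  {β ε c b δ : ℝ} {p : ZZ N} {m : ENNReal}

theorem abs_integral_smul_dirac_sub_integral_le {L : ℝ} (hβ : 1 ≤ β) (hε : 0 < ε) (hc : 1 ≤ c)
    (hb : β * ε ^ 2 ≤ b) (hL : 0 ≤ L) (hδ : 0 ≤ δ)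
    (hmom : ∫⁻ y, ENNReal.ofReal (‖y - p‖ ^ 2) ∂κ ≤ ENNReal.ofReal (ε ^ 2) * κ Set.univ)
    (hm₁ : m ≤ (1 + ENNReal.ofReal δ) * κ Set.univ)
    (hm₂ : κ Set.univ ≤ m + ENNReal.ofReal δ * κ Set.univ)
    {z : ZZ N} (hcell : ∀ᵐ y ∂κ, ‖p - z‖ ^ 2 ≤ c ^ 2 * (ε ^ 2 + ‖y - z‖ ^ 2))
    {F : ZZ N → ℝ} (hF : ∀ y, |F y| ≤ 1) (hFm : Measurable F)
    (hFL : ∀ y, |F p - F y| ≤ L * ‖y - p‖) :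
    |(Bconst N β)⁻¹ * (∫ y, F y * exp (-β * ‖y - z‖ ^ 2) ∂(m • Measure.dirac p)) -
        (Bconst N β)⁻¹ * (∫ y, F y * exp (-β * ‖y - z‖ ^ 2) ∂κ)| ≤
      flatConst N c b L * (δ + √β * ε) * ((Bconst N (β / (4 * c ^ 2)))⁻¹ *
        ∫ y, exp (-(β / (4 * c ^ 2)) * ‖y - z‖ ^ 2) ∂κ) := by
  have hκ : κ Set.univ ≠ ⊤ := measure_ne_top κ _
  have hm : m ≠ ⊤ := ne_top_of_le_ne_top (by finiteness) hm₁
  have hB := Bconst_pos N (by linarith : 0 < β)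
  have hint : Integrable (fun y => ‖y - p‖ ^ 2) κ := by
    refine ⟨Continuous.aestronglyMeasurable (by fun_prop), ?_⟩
    rw [hasFiniteIntegral_iff_ofReal (ae_of_all _ fun y => by positivity)]
    exact hmom.trans_lt (by finiteness)
  have hmom' : ∫ y, ‖y - p‖ ^ 2 ∂κ ≤ ε ^ 2 * κ.real Set.univ := by
    rw [← ofReal_integral_eq_lintegral_ofReal hint (ae_of_all _ fun y => by positivity),
      ← ofReal_measureReal hκ, ← ENNReal.ofReal_mul (sq_nonneg ε)] at hmom
    exact (ENNReal.ofReal_le_ofReal_iff (by positivity)).1 hmom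
  have hM : |m.toReal - κ.real Set.univ| ≤ δ * κ.real Set.univ := by
    have h1 := ENNReal.toReal_mono (by finiteness) hm₁
    have h2 := ENNReal.toReal_mono (by finiteness) hm₂
    rw [ENNReal.toReal_mul, ENNReal.toReal_add (by simp) (by simp), ENNReal.toReal_ofReal hδ,
      ENNReal.toReal_one] at h1
    rw [ENNReal.toReal_add hm (by finiteness), ENNReal.toReal_mul, ENNReal.toReal_ofReal hδ] at h2
    rw [abs_le, measureReal_def]
    constructor <;> linarith
  have h := abs_weighted_value_sub_integral_le κ hβ hε hc hb hL hint hmom' hcell hM hδ hF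
    hFm.aestronglyMeasurable hFL
  rw [integral_smul_measure, integral_dirac, smul_eq_mul, ← mul_sub, abs_mul,
    abs_of_pos (inv_pos.2 hB)]
  refine (mul_le_mul_of_nonneg_left h (inv_pos.2 hB).le).trans_eq ?_
  rw [inv_Bconst_eq_mul_inv_Bconst_div N (by linarith : 0 < β) (by positivity : 0 < 4 * c ^ 2),
    flatConst]
  ring

theorem therm_smul_dirac_univ_le (hβ : 1 ≤ β) (hε : 0 < ε) (hc : 1 ≤ c)
    (hb : β * ε ^ 2 ≤ b) (hδ : 0 ≤ δ) [SFinite (muE N E)]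
    (hmom : ∫⁻ y, ENNReal.ofReal (‖y - p‖ ^ 2) ∂κ ≤ ENNReal.ofReal (ε ^ 2) * κ Set.univ)
    (hm₁ : m ≤ (1 + ENNReal.ofReal δ) * κ Set.univ)
    (hm₂ : κ Set.univ ≤ m + ENNReal.ofReal δ * κ Set.univ)
    (hcell : ∀ z ∈ E, ∀ᵐ y ∂κ, ‖p - z‖ ^ 2 ≤ c ^ 2 * (ε ^ 2 + ‖y - z‖ ^ 2)) :
    therm ((m • Measure.dirac p).prod (muE N E)) β Set.univ ≤
      ENNReal.ofReal ((4 * c ^ 2) ^ N + flatConst N c b 0 * (δ + √β * ε)) *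
        therm (κ.prod (muE N E)) (β / (4 * c ^ 2)) Set.univ := by
  have hm : m ≠ ⊤ := ne_top_of_le_ne_top (by finiteness) hm₁
  have := Measure.smul_finite (Measure.dirac p) hm
  have hβ0 : 0 < β := by linarith
  have hb0 : 0 ≤ b := le_trans (by positivity) hb
  have hγ : 0 < β / (4 * c ^ 2) := by positivity
  have hBγ := Bconst_pos N hγ
  have hC := flatConst_pos N hc hb0 le_rfl
  refine therm_prod_univ_le _ κ _ hβ0 hγ (by positivity) ?_
  filter_upwards [ae_muE_mem E] with z hz
  have h := (abs_le.1 (abs_integral_smul_dirac_sub_integral_le κ hβ hε hc hb le_rfl hδ hmom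
    hm₁ hm₂ (hcell z hz) (F := fun _ => 1) (by simp) measurable_const (by simp))).2
  simp only [one_mul] at h
  have hmono : ∫ y, exp (-β * ‖y - z‖ ^ 2) ∂κ ≤
      ∫ y, exp (-(β / (4 * c ^ 2)) * ‖y - z‖ ^ 2) ∂κ := by
    refine integral_mono (integrable_exp_neg_mul_norm_sub_sq κ hβ0.le z)
      (integrable_exp_neg_mul_norm_sub_sq κ hγ.le z) fun y => ?_
    have : β / (4 * c ^ 2) ≤ β := div_le_self hβ0.le (by nlinarith)
    dsimp only
    gcongr
  have hκ : (Bconst N β)⁻¹ * ∫ y, exp (-β * ‖y - z‖ ^ 2) ∂κ ≤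
      (4 * c ^ 2) ^ N * ((Bconst N (β / (4 * c ^ 2)))⁻¹ *
        ∫ y, exp (-(β / (4 * c ^ 2)) * ‖y - z‖ ^ 2) ∂κ) := by
    rw [inv_Bconst_eq_mul_inv_Bconst_div N hβ0 (by positivity : 0 < 4 * c ^ 2), mul_assoc]
    gcongr
  rw [add_mul]
  linarith

end ThermCell

theorem integral_therm_discrete_sub_le {N : ℕ} {ι : Type*} (κ : ι → Measure (ZZ N))
    [∀ i, IsFiniteMeasure (κ i)] {E : AffineSubspace ℝ (ZZ N)} [SFinite (muE N E)]
    {β ε c b δ L : ℝ} {p : ι → ZZ N} {m : ι → ENNReal}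
    (hβ : 1 ≤ β) (hε : 0 < ε) (hc : 1 ≤ c) (hb : β * ε ^ 2 ≤ b) (hδ : 0 ≤ δ) (hL : 0 ≤ L)
    (hmom : ∀ i, ∫⁻ y, ENNReal.ofReal (‖y - p i‖ ^ 2) ∂κ i ≤
      ENNReal.ofReal (ε ^ 2) * κ i Set.univ)
    (hm₁ : ∀ i, m i ≤ (1 + ENNReal.ofReal δ) * κ i Set.univ)
    (hm₂ : ∀ i, κ i Set.univ ≤ m i + ENNReal.ofReal δ * κ i Set.univ)
    (hcell : ∀ i, ∀ z ∈ E, ∀ᵐ y ∂κ i, ‖p i - z‖ ^ 2 ≤ c ^ 2 * (ε ^ 2 + ‖y - z‖ ^ 2))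
    (hfin : therm ((Measure.sum κ).prod (muE N E)) β Set.univ < ⊤)
    (hfinγ : therm ((Measure.sum κ).prod (muE N E)) (β / (4 * c ^ 2)) Set.univ < ⊤)
    {f : ZZ N × ZZ N → ℝ} (hf : ∀ q, |f q| ≤ 1) (hfm : Measurable f)
    (hfL : ∀ x y z, |f (x, z) - f (y, z)| ≤ L * ‖y - x‖) :
    (∫ q, f q ∂therm ((Measure.sum fun i => m i • Measure.dirac (p i)).prod (muE N E)) β) -
        (∫ q, f q ∂therm ((Measure.sum κ).prod (muE N E)) β) ≤
      flatConst N c b L * (δ + √β * ε) *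
        (therm ((Measure.sum κ).prod (muE N E)) (β / (4 * c ^ 2))).real Set.univ := by
  have hβ0 : 0 < β := by linarith
  have hγ : 0 < β / (4 * c ^ 2) := by positivity
  have hm : ∀ i, m i ≠ ⊤ := fun i => ne_top_of_le_ne_top (by finiteness) (hm₁ i)
  have hsmul : ∀ i, IsFiniteMeasure (m i • Measure.dirac (p i)) :=
    fun i => Measure.smul_finite _ (hm i)
  have hfin₁ : therm ((Measure.sum fun i => m i • Measure.dirac (p i)).prod (muE N E)) β
      Set.univ < ⊤ := by
    rw [therm_sum, Measure.sum_apply _ MeasurableSet.univ]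
    refine (ENNReal.tsum_le_tsum fun i => therm_smul_dirac_univ_le (κ i) hβ hε hc hb hδ (hmom i)
      (hm₁ i) (hm₂ i) (hcell i)).trans_lt ?_
    rw [therm_sum, Measure.sum_apply _ MeasurableSet.univ] at hfinγ
    rw [ENNReal.tsum_mul_left]
    exact ENNReal.mul_lt_top ENNReal.ofReal_lt_top hfinγ
  rw [therm_sum] at hfin hfin₁ hfinγ ⊢
  rw [therm_sum, therm_sum]
  have hsub : ∀ {ν : ι → Measure (ZZ N × ZZ N)}, Measure.sum ν Set.univ < ⊤ →
      ∀ i, ν i Set.univ < ⊤ :=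
    fun h i => (Measure.le_sum _ i Set.univ).trans_lt h
  have hsum : ∀ {ν : ι → Measure (ZZ N × ZZ N)}, Measure.sum ν Set.univ < ⊤ →
      ∀ {g : ZZ N × ZZ N → ℝ}, (∀ q, |g q| ≤ 1) → Measurable g →
      HasSum (fun i => ∫ q, g q ∂ν i) (∫ q, g q ∂Measure.sum ν) := by
    intro ν hν g hg hgm
    have : IsFiniteMeasure (Measure.sum ν) := ⟨hν⟩
    exact hasSum_integral_measure
      (Integrable.of_bound hgm.aestronglyMeasurable 1 (ae_of_all _ hg))
  have hmass := hsum hfinγ (g := fun _ => 1) (by simp) measurable_const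
  simp only [integral_const, smul_eq_mul, mul_one] at hmass
  refine hasSum_le (fun i => ?_) ((hsum hfin₁ hf hfm).sub (hsum hfin hf hfm))
    (hmass.mul_left _)
  refine integral_therm_sub_integral_therm_le _ (κ i) _ hβ0 hγ (hsub hfin₁ i) (hsub hfin i)
    (hsub hfinγ i) hf hfm ?_
  filter_upwards [ae_muE_mem E] with z hz
  exact (abs_le.1 (abs_integral_smul_dirac_sub_integral_le (κ i) hβ hε hc hb hL hδ (hmom i)
    (hm₁ i) (hm₂ i) (hcell i z hz) (F := fun y => f (y, z)) (fun y => hf _)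
    (hfm.comp measurable_prodMk_right) fun y => hfL _ _ _)).2

/-!
STATEMENT 14: convergence in the flat norm (Corollary). Under hypotheses (1)–(5)
of the discrete approximation result, if in addition `|m_p − μ_D(A_p)| ≤ δ_h μ_D(A_p)`
with `δ_h → 0`, then there is a constant `C` such that for all sufficiently large `h`,
`‖(μ_h)_{β_h} − μ_{β_h}‖_FN ≤ C (δ_h + β_h^{1/2} ε_h) · sup_{β ≥ β₀} ‖μ_β‖_TV`.
The flat norm is expressed via its defining supremum over functions `f` with
`‖f‖_∞ ≤ 1` and `ℓ·Lip(f) ≤ 1`.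
-/

theorem discrete_approximation_flat_norm_bound
    (N : ℕ) (μD : Measure (ZZ N))
    (E : AffineSubspace ℝ (ZZ N)) (hE : (E : Set (ZZ N)).Nonempty)
    (hdim : Module.finrank ℝ E.direction = N)
    (ℓ : ℝ) (hℓ : 0 < ℓ)
    (β₀ : ℝ) (hβ₀ : 0 < β₀)
    -- (1) uniform boundedness and tightness of the thermalizations of μ = μ_D × μ_E
    (hbd : ∃ C : ENNReal, C < ⊤ ∧ ∀ β : ℝ, β₀ ≤ β →
      (therm (μD.prod (muE N E)) β) Set.univ ≤ C)
    (htight : ∀ δ : ℝ, 0 < δ → ∃ K : Set (ZZ N × ZZ N), IsCompact K ∧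
      ∀ β : ℝ, β₀ ≤ β → (therm (μD.prod (muE N E)) β) Kᶜ < ENNReal.ofReal δ)
    -- annealing and resolution sequences
    (β : ℕ → ℝ) (hβ : Tendsto β atTop atTop)
    (ε : ℕ → ℝ) (hεpos : ∀ h, 0 < ε h) (hε : Tendsto ε atTop (𝓝 0))
    -- for every h, a countable Borel partition {A_p : p ∈ P_h} of Z with p ∈ A_p
    (ι : ℕ → Type) [∀ h, Countable (ι h)]
    (p : ∀ h, ι h → ZZ N) (A : ∀ h, ι h → Set (ZZ N))
    (hAmeas : ∀ h i, MeasurableSet (A h i))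
    (hdisj : ∀ h, Pairwise fun i j => Disjoint (A h i) (A h j))
    (hcover : ∀ h, (⋃ i, A h i) = Set.univ)
    (hpA : ∀ h i, p h i ∈ A h i)
    (hAfin : ∀ h i, μD (A h i) < ⊤)
    -- weights
    (m : ∀ h, ι h → ENNReal)
    -- (2) m_p ≤ c̄ μ_D(A_p)
    (cbar : ℝ) (hcbar : 0 < cbar)
    (hm : ∀ h i, m h i ≤ ENNReal.ofReal cbar * μD (A h i))
    -- (3) (β_h ε_h²) is bounded
    (hβε : ∃ Cb : ℝ, ∀ h, |β h * (ε h) ^ 2| ≤ Cb)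
    -- (4) ‖p − z‖² ≤ c_*²(ε_h² + ‖y − z‖²)
    (cstar : ℝ) (hcstar : 1 ≤ cstar)
    (hcell : ∀ h, ∀ i, ∀ z ∈ E, ∀ y ∈ A h i,
      ‖p h i - z‖ ^ 2 ≤ cstar ^ 2 * ((ε h) ^ 2 + ‖y - z‖ ^ 2))
    -- (5) second moments
    (hmom : ∀ h i, ∫⁻ y in A h i, ENNReal.ofReal (‖y - p h i‖ ^ 2) ∂μD
      ≤ ENNReal.ofReal ((ε h) ^ 2) * μD (A h i))
    -- additional weight-accuracy hypothesis: |m_p − μ_D(A_p)| ≤ δ_h μ_D(A_p), δ_h → 0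
    (δ : ℕ → ℝ) (hδnn : ∀ h, 0 ≤ δ h) (hδ : Tendsto δ atTop (𝓝 0))
    (hmδ : ∀ h i, m h i ≤ (1 + ENNReal.ofReal (δ h)) * μD (A h i) ∧
      μD (A h i) ≤ m h i + ENNReal.ofReal (δ h) * μD (A h i)) :
    ∃ C : ℝ, 0 < C ∧ ∃ h₀ : ℕ, ∀ h, h₀ ≤ h →
      ∀ f : ZZ N × ZZ N → ℝ, (∀ q, |f q| ≤ 1) →
        LipschitzWith (Real.toNNReal ℓ)⁻¹ f →
        (∫ q, f q ∂(therm ((Measure.sum fun i => m h i • Measure.dirac (p h i)).prod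
            (muE N E)) (β h))) -
          (∫ q, f q ∂(therm (μD.prod (muE N E)) (β h)))
          ≤ C * (δ h + Real.sqrt (β h) * ε h) *
            (⨆ (β' : ℝ) (_ : β₀ ≤ β'), (therm (μD.prod (muE N E)) β') Set.univ).toReal := by
  obtain ⟨S, hS, hSbd⟩ := hbd
  obtain ⟨Cb, hCb⟩ := hβε
  have := sFinite_muE hE hdim
  have hb0 : 0 ≤ Cb := (abs_nonneg _).trans (hCb 0)
  have hL : 0 ≤ ℓ⁻¹ := (inv_pos.2 hℓ).le
  obtain ⟨h₀, hh₀⟩ := eventually_atTop.1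
    (hβ.eventually_ge_atTop (max 1 (max β₀ (β₀ * (4 * cstar ^ 2)))))
  refine ⟨flatConst N cstar Cb ℓ⁻¹, flatConst_pos N hcstar hb0 hL, h₀, fun h hh f hf hfLip => ?_⟩
  obtain ⟨hβ1, hββ₀, hγ⟩ : 1 ≤ β h ∧ β₀ ≤ β h ∧ β₀ ≤ β h / (4 * cstar ^ 2) := by
    have := hh₀ h hh
    simp only [max_le_iff] at this
    exact ⟨this.1, this.2.1, (le_div_iff₀ (by positivity)).2 this.2.2⟩
  have hμD : μD = Measure.sum fun i => μD.restrict (A h i) := by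
    rw [← Measure.restrict_iUnion (hdisj h) (hAmeas h), hcover, Measure.restrict_univ]
  have hfinite : ∀ i, IsFiniteMeasure (μD.restrict (A h i)) :=
    fun i => isFiniteMeasure_restrict.2 (hAfin h i).ne
  have hbound := integral_therm_discrete_sub_le (fun i => μD.restrict (A h i)) (E := E)
    (p := p h) (m := m h) hβ1 (hεpos h) hcstar ((le_abs_self _).trans (hCb h)) (hδnn h) hL
    (by simpa using hmom h) (by simpa using fun i => (hmδ h i).1)
    (by simpa using fun i => (hmδ h i).2)
    (fun i z hz => (ae_restrict_mem (hAmeas h i)).mono (hcell h i z hz))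
    (by rw [← hμD]; exact (hSbd _ hββ₀).trans_lt hS)
    (by rw [← hμD]; exact (hSbd _ hγ).trans_lt hS)
    hf hfLip.continuous.measurable (fun x y z => by
      have := hfLip.dist_le_mul (x, z) (y, z)
      rw [dist_prod_same_right, dist_comm x y, dist_eq_norm y x, Real.dist_eq] at this
      simpa [hℓ.le] using this)
  rw [← hμD] at hbound
  refine hbound.trans ?_
  have hC := flatConst_pos N hcstar hb0 hL
  have hε0 := hεpos h
  have hδ0 := hδnn h
  gcongr
  refine ENNReal.toReal_mono (ne_top_of_le_ne_top hS.ne (iSup₂_le hSbd)) ?_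
  exact le_iSup₂ (f := fun (β' : ℝ) (_ : β₀ ≤ β') => therm (μD.prod (muE N E)) β' Set.univ)
    _ hγ
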